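/- arXiv:2211.00211 — 2 statements merged into one kernel-verified Lean document; each statement's English description precedes it below -/
import Mathlib

section
/- Let (W,S) be a finite Coxeter system, R a commutative ring with unit, a,b ∈ R, and I, J ⊆ S. If w ∈ {}^J W^I is a minimal-length double coset representative and κ ∈ W_{K(w)}, then in H_W(a,b) one has π_κ π_w = π_w π_{w^{-1} κ w}; that is, π_κ π_w = π_w c_w(π_κ), where c_w : H_{K(w)} → H_{w^{-1}K(w)w} is the algebra isomorphism determined by c_w(π_k) = π_{w^{-1} k w} for k ∈ K(w). -/
/-- The alternating product `(x y x ⋯)_n` with `n` factors. -/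
def altProd {A : Type*} [Monoid A] : A → A → ℕ → A
  | _, _, 0 => 1
  | x, y, n + 1 => x * altProd y x n

/-- The defining relations of the two-variable Hecke algebra `H_W(a, b)` of a Coxeter system
whose Coxeter matrix is `Cm`: the quadratic relations `π_s π_s = a π_s + b` and the braid
relations `(π_s π_t π_s ⋯)_{m(s,t)} = (π_t π_s π_t ⋯)_{m(s,t)}`. -/
inductive HeckeRel (R : Type*) [CommRing R] (a b : R) {B : Type*} (Cm : CoxeterMatrix B) :
    FreeAlgebra R B → FreeAlgebra R B → Prop
  | quad (i : B) :
      HeckeRel R a b Cm (FreeAlgebra.ι R i * FreeAlgebra.ι R i)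
        (a • FreeAlgebra.ι R i + algebraMap R (FreeAlgebra R B) b)
  | braid (i j : B) (hij : i ≠ j) :
      HeckeRel R a b Cm (altProd (FreeAlgebra.ι R i) (FreeAlgebra.ι R j) (Cm i j))
        (altProd (FreeAlgebra.ι R j) (FreeAlgebra.ι R i) (Cm i j))

/-- The two-variable Hecke algebra `H_W(a, b)` over `R` of a Coxeter system with Coxeter
matrix `Cm`. -/
def HeckeAlg (R : Type*) [CommRing R] (a b : R) {B : Type*} (Cm : CoxeterMatrix B) : Type _ :=
  RingQuot (HeckeRel R a b Cm)

namespace HeckeAlg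

variable (R : Type*) [CommRing R] (a b : R) {B : Type*} (Cm : CoxeterMatrix B)

instance : Ring (HeckeAlg R a b Cm) := inferInstanceAs (Ring (RingQuot (HeckeRel R a b Cm)))

instance : Algebra R (HeckeAlg R a b Cm) :=
  inferInstanceAs (Algebra R (RingQuot (HeckeRel R a b Cm)))

/-- The generator `π_s` of the two-variable Hecke algebra. -/
noncomputable def pi (i : B) : HeckeAlg R a b Cm :=
  RingQuot.mkAlgHom R (HeckeRel R a b Cm) (FreeAlgebra.ι R i)

/-- The parabolic subalgebra `H_I` of the two-variable Hecke algebra corresponding to a subset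
`I` of the simple generators. -/
noncomputable def parabolic (I : Set B) : Subalgebra R (HeckeAlg R a b Cm) :=
  Algebra.adjoin R (HeckeAlg.pi R a b Cm '' I)

end HeckeAlg

/-- The index set of `K(w) := J ∩ (w I w⁻¹)`, a subset of the simple reflections. -/
def coxK {B W : Type*} [Group W] {Cm : CoxeterMatrix B} (cs : CoxeterSystem Cm W)
    (I J : Set B) (w : W) : Set B :=
  {j | j ∈ J ∧ ∃ i ∈ I, cs.simple j = w * cs.simple i * w⁻¹}

/-- The index set of `w⁻¹ K(w) w := (w⁻¹ J w) ∩ I`, a subset of the simple reflections. -/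
def coxK' {B W : Type*} [Group W] {Cm : CoxeterMatrix B} (cs : CoxeterSystem Cm W)
    (I J : Set B) (w : W) : Set B :=
  {i | i ∈ I ∧ ∃ j ∈ J, cs.simple i = w⁻¹ * cs.simple j * w}

/-- The parabolic (standard) subgroup `W_X` generated by a subset `X` of the simple
reflections. -/
def coxParabolicSubgroup {B W : Type*} [Group W] {Cm : CoxeterMatrix B}
    (cs : CoxeterSystem Cm W) (X : Set B) : Subgroup W :=
  Subgroup.closure (cs.simple '' X)

/-- `W^I`: the set of minimal length representatives of the left cosets `W / W_I`. -/
def coxMinLeftCosetReps {B W : Type*} [Group W] {Cm : CoxeterMatrix B}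
    (cs : CoxeterSystem Cm W) (I : Set B) : Set W :=
  {w | ∀ u ∈ coxParabolicSubgroup cs I, cs.length w ≤ cs.length (w * u)}

/-- `ᴶW`: the set of minimal length representatives of the right cosets `W_J \ W`. -/
def coxMinRightCosetReps {B W : Type*} [Group W] {Cm : CoxeterMatrix B}
    (cs : CoxeterSystem Cm W) (J : Set B) : Set W :=
  {w | ∀ u ∈ coxParabolicSubgroup cs J, cs.length w ≤ cs.length (u * w)}

/-- `ᴶWᴵ := ᴶW ∩ Wᴵ`: the set of minimal length representatives of the double cosets
`W_J \ W / W_I`. -/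
def coxMinDoubleCosetReps {B W : Type*} [Group W] {Cm : CoxeterMatrix B}
    (cs : CoxeterSystem Cm W) (I J : Set B) : Set W :=
  coxMinRightCosetReps cs J ∩ coxMinLeftCosetReps cs I

open Classical in
/-- The generators of the reflection representation on `W × ZMod 2`. -/
noncomputable def reflGen {B W : Type*} [Group W] {M : CoxeterMatrix B} (cs : CoxeterSystem M W)
    (i : B) : Function.End (W × ZMod 2) :=
  fun p => (cs.simple i * p.1 * cs.simple i, p.2 + if p.1 = cs.simple i then 1 else 0)

section
variable {B W : Type*} [Group W] {M : CoxeterMatrix B} (cs : CoxeterSystem M W)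

lemma simple_rho (i j : B) (k : ℕ) :
    (cs.simple i * cs.simple j) ^ k * cs.simple j * (cs.simple i * cs.simple j) ^ k
      = cs.simple j := by
  induction k with
  | zero => simp
  | succ k ih =>
    calc _ = (cs.simple i * cs.simple j) ^ k * (cs.simple i * cs.simple j) * cs.simple j *
          ((cs.simple i * cs.simple j) * (cs.simple i * cs.simple j) ^ k) := by
            rw [← pow_succ, ← pow_succ']
      _ = (cs.simple i * cs.simple j) ^ k * (cs.simple i * (cs.simple j * cs.simple j)
          * cs.simple i) * cs.simple j * (cs.simple i * cs.simple j) ^ k := by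
            simp only [mul_assoc]
      _ = _ := by simpa using ih

open Classical in
lemma reflGen_pow (i j : B) (k : ℕ) (t : W) (e : ZMod 2) :
    ((reflGen cs i * reflGen cs j) ^ k) (t, e) =
      ((cs.simple i * cs.simple j) ^ k * t * ((cs.simple i * cs.simple j) ^ k)⁻¹,
        e + ∑ q ∈ Finset.range (2 * k),
          if t = cs.simple j * (cs.simple i * cs.simple j) ^ q then 1 else 0) := by
  induction k with
  | zero => simp; rfl
  | succ k ih =>
    rw [pow_succ']
    change reflGen cs i (reflGen cs j (((reflGen cs i * reflGen cs j) ^ k) (t, e))) = _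
    rw [ih, show 2 * (k + 1) = 2 * k + 1 + 1 by ring, Finset.sum_range_succ,
      Finset.sum_range_succ]
    have h0 := simple_rho cs i j k
    have hj := cs.simple_mul_simple_self j
    have hi := cs.simple_mul_simple_self i
    have hji := cs.inv_simple j
    have hii := cs.inv_simple i
    unfold reflGen
    set ρ := cs.simple i * cs.simple j with hρ
    have h3 : cs.simple j * ρ ^ k = (ρ ^ k)⁻¹ * cs.simple j := by
      rw [eq_inv_mul_iff_mul_eq, ← mul_assoc, h0]
    have h1 : ρ ^ k * t * (ρ ^ k)⁻¹ = cs.simple j ↔ t = cs.simple j * ρ ^ (2 * k) := by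
      have : cs.simple j * ρ ^ (2 * k) = (ρ ^ k)⁻¹ * cs.simple j * ρ ^ k := by
        rw [two_mul, pow_add, ← mul_assoc, h3]
      rw [this, mul_inv_eq_iff_eq_mul, mul_assoc, eq_inv_mul_iff_mul_eq]
    have h2 : cs.simple j * (ρ ^ k * t * (ρ ^ k)⁻¹) * cs.simple j = cs.simple i ↔
        t = cs.simple j * ρ ^ (2 * k + 1) := by
      have : cs.simple j * ρ ^ (2 * k + 1) =
          (ρ ^ k)⁻¹ * (cs.simple j * cs.simple i * cs.simple j) * ρ ^ k := by
        rw [show 2 * k + 1 = k + (1 + k) by ring, pow_add, pow_add, pow_one, ← mul_assoc, h3, hρ]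
        simp only [mul_assoc]
      rw [this]
      constructor
      · intro h
        rw [← h]
        simp [mul_assoc]
      · intro h
        rw [h]
        simp [mul_assoc]
    simp only [h1, h2]
    ext
    · simp [pow_succ', hρ, mul_assoc]
    · simp [add_assoc]

lemma reflGen_liftable : M.IsLiftable (reflGen cs) := by
  classical
  intro i j
  funext ⟨t, e⟩
  rw [reflGen_pow, cs.simple_mul_simple_pow, two_mul, Finset.sum_range_add]
  simp only [pow_add, cs.simple_mul_simple_pow, one_mul]
  rw [CharTwo.add_self_eq_zero]
  simp
  rfl

/-- The reflection representation on `W × ZMod 2`. -/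
noncomputable def reflHom : W →* Function.End (W × ZMod 2) :=
  cs.lift ⟨reflGen cs, reflGen_liftable cs⟩

open Classical in
lemma reflHom_wordProd (ω : List B) (t : W) (e : ZMod 2) :
    reflHom cs (cs.wordProd ω) (t, e) =
      (cs.wordProd ω * t * (cs.wordProd ω)⁻¹, e + ((cs.rightInvSeq ω).count t : ℕ)) := by
  induction ω with
  | nil => simp; rfl
  | cons i ω ih =>
    rw [cs.wordProd_cons, map_mul]
    change reflHom cs (cs.simple i) (reflHom cs (cs.wordProd ω) (t, e)) = _
    rw [ih, reflHom, cs.lift_apply_simple, reflGen]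
    ext
    · simp [mul_assoc]
    · simp only [CoxeterSystem.rightInvSeq, List.count_cons]
      have : cs.wordProd ω * t * (cs.wordProd ω)⁻¹ = cs.simple i ↔
          (cs.wordProd ω)⁻¹ * cs.simple i * cs.wordProd ω = t := by
        constructor
        · intro h; rw [← h]; group
        · intro h; rw [← h]; group
      simp only [this, beq_iff_eq]
      split_ifs <;> simp [add_assoc]

/-- The exchange property on the right. -/
lemma exchange_right (ω : List B) (i : B)
    (h : cs.IsRightDescent (cs.wordProd ω) i) :
    ∃ j < ω.length, cs.wordProd ω * cs.simple i = cs.wordProd (ω.eraseIdx j) := by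
  classical
  obtain ⟨ω', hr, hω'⟩ := cs.exists_isReduced (cs.wordProd ω * cs.simple i)
  have hp : cs.wordProd ω = cs.wordProd (ω'.concat i) := by
    rw [cs.wordProd_concat, ← hω']; simp
  have hr' : cs.IsReduced (ω'.concat i) := by
    have h1 := cs.isRightDescent_iff.1 h
    rw [hω', hr.eq] at h1
    unfold CoxeterSystem.IsReduced
    rw [← hp]; simpa using h1.symm
  have h2 := reflHom_wordProd cs ω (cs.simple i) 0
  rw [hp, reflHom_wordProd cs (ω'.concat i)] at h2
  have h3 := congrArg Prod.snd h2
  simp only [zero_add] at h3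
  have hm : cs.simple i ∈ cs.rightInvSeq (ω'.concat i) := by
    rw [cs.rightInvSeq_concat]; simp
  rw [List.count_eq_one_of_mem hr'.nodup_rightInvSeq hm] at h3
  have hm' : cs.simple i ∈ cs.rightInvSeq ω := by
    by_contra hn
    rw [List.count_eq_zero_of_not_mem hn] at h3
    simp at h3
  obtain ⟨j, hj, hje⟩ := List.mem_iff_getElem.1 hm'
  refine ⟨j, by simpa using hj, ?_⟩
  rw [← cs.wordProd_mul_getD_rightInvSeq, List.getD_eq_getElem _ _ hj, hje]

/-- The exchange property on the left. -/
lemma exchange_left (ω : List B) (i : B)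
    (h : cs.IsLeftDescent (cs.wordProd ω) i) :
    ∃ j < ω.length, cs.simple i * cs.wordProd ω = cs.wordProd (ω.eraseIdx j) := by
  obtain ⟨j, hj, he⟩ := exchange_right cs ω.reverse i (by
    rw [cs.wordProd_reverse]; exact cs.isRightDescent_inv_iff.2 h)
  simp only [List.length_reverse] at hj
  refine ⟨ω.length - 1 - j, by omega, ?_⟩
  have h2 := congrArg (·⁻¹) he
  simp only [cs.wordProd_reverse, mul_inv_rev, inv_inv, cs.inv_simple] at h2
  rw [h2, ← cs.wordProd_reverse]
  congr 1
  rw [List.eraseIdx_eq_take_drop_succ, List.eraseIdx_eq_take_drop_succ]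
  simp only [List.reverse_append, List.reverse_reverse, List.take_reverse, List.drop_reverse]
  congr 2 <;> omega

lemma parabolic_word (X : Set B) (u : W) (hu : u ∈ coxParabolicSubgroup cs X) :
    ∃ ω : List B, (∀ i ∈ ω, i ∈ X) ∧ cs.IsReduced ω ∧ u = cs.wordProd ω := by
  have key : ∀ i ∈ X, ∀ v : W,
      (∃ ω : List B, (∀ i ∈ ω, i ∈ X) ∧ cs.IsReduced ω ∧ v = cs.wordProd ω) →
      ∃ ω : List B, (∀ i ∈ ω, i ∈ X) ∧ cs.IsReduced ω ∧ cs.simple i * v = cs.wordProd ω := by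
    rintro i hi _ ⟨ω, hX, hr, rfl⟩
    by_cases hd : cs.IsLeftDescent (cs.wordProd ω) i
    · obtain ⟨j, hj, he⟩ := exchange_left cs ω i hd
      refine ⟨ω.eraseIdx j, fun k hk => hX k (List.mem_of_mem_eraseIdx hk), ?_, he⟩
      have h1 := cs.isLeftDescent_iff.1 hd
      rw [he, hr.eq] at h1
      have := List.length_eraseIdx_add_one hj
      unfold CoxeterSystem.IsReduced
      omega
    · refine ⟨i :: ω, ?_, ?_, (cs.wordProd_cons i ω).symm⟩
      · simpa using ⟨hi, hX⟩
      · have h1 := cs.not_isLeftDescent_iff.1 hd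
        unfold CoxeterSystem.IsReduced
        rw [cs.wordProd_cons, h1, hr.eq]; rfl
  unfold coxParabolicSubgroup at hu
  induction hu using Subgroup.closure_induction_left with
  | one => exact ⟨[], by simp, by simp [CoxeterSystem.IsReduced], by simp⟩
  | mul_left x hx y hy ih =>
    obtain ⟨i, hi, rfl⟩ := hx
    exact key i hi y ih
  | inv_mul_cancel x hx y hy ih =>
    obtain ⟨i, hi, rfl⟩ := hx
    rw [cs.inv_simple]
    exact key i hi y ih

lemma wordProd_mem (X : Set B) (ω : List B) (h : ∀ i ∈ ω, i ∈ X) :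
    cs.wordProd ω ∈ coxParabolicSubgroup cs X := by
  induction ω with
  | nil => rw [cs.wordProd_nil]; exact one_mem _
  | cons i ω ih =>
    rw [cs.wordProd_cons]
    exact mul_mem (Subgroup.subset_closure ⟨i, h i (by simp), rfl⟩)
      (ih fun k hk => h k (by simp [hk]))

lemma reduced_append (X : Set B) (ν : List B) (hν : cs.IsReduced ν)
    (hmin : cs.wordProd ν ∈ coxMinRightCosetReps cs X) (ω : List B)
    (hX : ∀ i ∈ ω, i ∈ X) (hω : cs.IsReduced ω) : cs.IsReduced (ω ++ ν) := by
  induction ω with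
  | nil => simpa using hν
  | cons i ω ih =>
    have hω' : cs.IsReduced ω := by simpa using hω.drop 1
    have hX' : ∀ k ∈ ω, k ∈ X := fun k hk => hX k (by simp [hk])
    have hi : i ∈ X := hX i (by simp)
    have ih := ih hX' hω'
    by_cases hd : cs.IsLeftDescent (cs.wordProd (ω ++ ν)) i
    · exfalso
      obtain ⟨j, hj, he⟩ := exchange_left cs _ i hd
      by_cases hjl : j < ω.length
      · rw [List.eraseIdx_append_of_lt_length hjl, cs.wordProd_append, cs.wordProd_append,
          ← mul_assoc, mul_left_inj, ← cs.wordProd_cons] at he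
        have h1 := cs.length_wordProd_le (ω.eraseIdx j)
        rw [← he, hω.eq] at h1
        have := List.length_eraseIdx_add_one hjl
        simp at h1
        omega
      · push Not at hjl
        rw [List.eraseIdx_append_of_length_le hjl, cs.wordProd_append, cs.wordProd_append] at he
        have hm := wordProd_mem cs X ω hX'
        have hs : cs.simple i ∈ coxParabolicSubgroup cs X :=
          Subgroup.subset_closure ⟨i, hi, rfl⟩
        have h1 := hmin _ (mul_mem (mul_mem (inv_mem hm) hs) hm)
        rw [mul_assoc, mul_assoc, he, inv_mul_cancel_left, hν.eq] at h1
        have h2 := cs.length_wordProd_le (ν.eraseIdx (j - ω.length))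
        rw [List.length_append] at hj
        have := List.length_eraseIdx_add_one (l := ν) (i := j - ω.length) (by omega)
        omega
    · have h1 := cs.not_isLeftDescent_iff.1 hd
      unfold CoxeterSystem.IsReduced
      rw [List.cons_append, cs.wordProd_cons, h1, ih.eq]; rfl

end

/-- Lemma 2.4, second part. Let `(W,S)` be a finite Coxeter system and
`I, J ⊆ S`. If `w ∈ ᴶWᴵ` is a minimal length double coset representative and `κ ∈ W_{K(w)}`,
then in `H_W(a,b)` one has `π_κ π_w = π_w π_{w⁻¹ κ w}`. Here `πw : W → H_W(a,b)` is the
function `w ↦ π_w`. -/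
theorem heckeAlg_pi_conj_of_minDoubleCosetRep
    {R : Type*} [CommRing R] (a b : R) {B : Type*} {W : Type*} [Group W] [Finite W]
    (Cm : CoxeterMatrix B) (cs : CoxeterSystem Cm W) (I J : Set B)
    (πw : W → HeckeAlg R a b Cm)
    (hπw : ∀ l : List B, cs.IsReduced l →
      πw (cs.wordProd l) = (l.map (HeckeAlg.pi R a b Cm)).prod)
    (w : W) (hw : w ∈ coxMinDoubleCosetReps cs I J)
    (κ : W) (hκ : κ ∈ coxParabolicSubgroup cs (coxK cs I J w)) :
    πw κ * πw w = πw w * πw (w⁻¹ * κ * w) := by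
  have h1 : κ ∈ coxParabolicSubgroup cs J :=
    Subgroup.closure_mono (Set.image_mono fun j hj => hj.1) hκ
  have h2 : w⁻¹ * κ * w ∈ coxParabolicSubgroup cs I := by
    unfold coxParabolicSubgroup at hκ
    induction hκ using Subgroup.closure_induction with
    | mem x hx =>
      obtain ⟨j, ⟨_, i, hi, hji⟩, rfl⟩ := hx
      rw [hji]
      exact Subgroup.subset_closure ⟨i, hi, by group⟩
    | one => simp
    | mul x y hx hy ihx ihy =>
      have := mul_mem (ihx (Subgroup.closure_mono (Set.image_mono fun j hj => hj.1) hx))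
        (ihy (Subgroup.closure_mono (Set.image_mono fun j hj => hj.1) hy))
      convert this using 1
      group
    | inv x hx ih =>
      have := inv_mem (ih (Subgroup.closure_mono (Set.image_mono fun j hj => hj.1) hx))
      convert this using 1
      group
  obtain ⟨ν, hν, hwν⟩ := cs.exists_isReduced w
  obtain ⟨α, hαX, hα, hκα⟩ := parabolic_word cs J κ h1
  obtain ⟨β, hβX, hβ, hκβ⟩ := parabolic_word cs I _ h2
  have r1 : cs.IsReduced (α ++ ν) :=
    reduced_append cs J ν hν (by rw [← hwν]; exact hw.1) α hαX hα
  have r2 : cs.IsReduced (ν ++ β) := by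
    have := reduced_append cs I ν.reverse hν.reverse (by
      rw [cs.wordProd_reverse, ← hwν]
      intro u hu
      have := hw.2 _ (inv_mem hu)
      rw [← cs.length_inv (w * u⁻¹)] at this
      simpa using this) β.reverse (by simpa using hβX) hβ.reverse
    simpa using this.reverse
  have e : cs.wordProd (α ++ ν) = cs.wordProd (ν ++ β) := by
    rw [cs.wordProd_append, cs.wordProd_append, ← hκα, ← hκβ, ← hwν]; group
  rw [hκβ, hκα, hwν, hπw _ hα, hπw _ hν, hπw _ hβ, ← List.prod_append, ← List.prod_append,
    ← List.map_append, ← List.map_append, ← hπw _ r1, ← hπw _ r2, e]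
end

section
/- Let (W,S) be a Coxeter system, R a commutative ring with unit, and a,b ∈ R. Define the sequence (y_n)_{n ≥ 0} in R by y_0 = 0, y_1 = −a, and y_n = −a y_{n−1} + b y_{n−2} for n ≥ 2. Then for any generators π_i, π_j (i,j ∈ S) of H_W(a,b) and any n ≥ 1, ((π_i − a)(π_j − a)(π_i − a)⋯)_n = (π_i π_j π_i ⋯)_n + Σ_{m=1}^{n−1} y_{n−m} ( (π_i π_j π_i ⋯)_m + (π_j π_i π_j ⋯)_m ) + y_n, where (xyx⋯)_m denotes the alternating product of m factors. -/
/-- The sequence `(y_n)` with `y_0 = 0`, `y_1 = -a`, `y_n = -a y_{n-1} + b y_{n-2}`. -/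
def yseq {R : Type*} [CommRing R] (a b : R) : ℕ → R
  | 0 => 0
  | 1 => -a
  | n + 2 => -a * yseq a b (n + 1) + b * yseq a b n

/-- Convolution of `yseq` with a sequence. -/
def yconv {R A : Type*} [CommRing R] [Ring A] [Algebra R A] (a b : R) (f : ℕ → A) (n : ℕ) : A :=
  ∑ m ∈ Finset.range n, yseq a b (n - m) • f m

lemma yconv_rec {R A : Type*} [CommRing R] [Ring A] [Algebra R A] (a b : R) (f : ℕ → A) (n : ℕ) :
    yconv a b f (n + 2) =
      -(a • f (n + 1)) - a • yconv a b f (n + 1) + b • yconv a b f n := by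
  have h1 : ∑ m ∈ Finset.range n, yseq a b (n + 2 - m) • f m
      = -(a • ∑ m ∈ Finset.range n, yseq a b (n + 1 - m) • f m)
        + b • ∑ m ∈ Finset.range n, yseq a b (n - m) • f m := by
    rw [Finset.smul_sum, Finset.smul_sum, ← Finset.sum_neg_distrib, ← Finset.sum_add_distrib]
    refine Finset.sum_congr rfl fun m hm => ?_
    have hm' := Finset.mem_range.1 hm
    obtain ⟨k, rfl⟩ := Nat.exists_eq_add_of_lt hm'
    have e1 : m + k + 1 + 2 - m = (k + 1) + 2 := by omega
    have e2 : m + k + 1 + 1 - m = (k + 1) + 1 := by omega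
    have e3 : m + k + 1 - m = k + 1 := by omega
    rw [e1, e2, e3, yseq]
    module
  unfold yconv
  rw [Finset.sum_range_succ, Finset.sum_range_succ, h1, Finset.sum_range_succ]
  have e1 : n + 2 - n = 2 := by omega
  have e2 : n + 2 - (n + 1) = 1 := by omega
  have e3 : n + 1 - n = 1 := by omega
  rw [e1, e2, e3]
  simp only [yseq]
  module

lemma yconv_alt {R A : Type*} [CommRing R] [Ring A] [Algebra R A] (a b : R) (x y : A) (n : ℕ) :
    yconv a b (altProd x y) (n + 1) =
      x * yconv a b (altProd y x) n + algebraMap R A (yseq a b (n + 1)) := by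
  unfold yconv
  rw [Finset.sum_range_succ', Finset.mul_sum]
  congr 1
  · refine Finset.sum_congr rfl fun m _ => ?_
    rw [altProd, mul_smul_comm, Nat.add_sub_add_right]
  · simp [altProd, Algebra.algebraMap_eq_smul_one]

lemma altProd_sub_aux {R A : Type*} [CommRing R] [Ring A] [Algebra R A] (a b : R) (n : ℕ) :
    ∀ x y : A, x * x = a • x + algebraMap R A b → y * y = a • y + algebraMap R A b →
    altProd (x - algebraMap R A a) (y - algebraMap R A a) (n + 1) =
      altProd x y (n + 1) + yconv a b (altProd x y) (n + 1) + yconv a b (altProd y x) (n + 1)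
        - algebraMap R A (yseq a b (n + 1)) := by
  induction n with
  | zero =>
    intro x y _ _
    simp [altProd, yconv, yseq, Algebra.algebraMap_eq_smul_one]
    abel
  | succ n ih =>
    intro x y hx hy
    rw [altProd, ih y x hy hx, yconv_rec a b (altProd y x), yconv_alt a b x y (n + 1),
      yconv_alt a b x y n]
    rw [show altProd x y (n + 1 + 1) = x * altProd y x (n + 1) from rfl]
    generalize yconv a b (altProd y x) (n + 1) = S
    generalize yconv a b (altProd y x) n = T
    generalize altProd y x (n + 1) = P
    have hT : (x - algebraMap R A a) * (x * T) = b • T := by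
      rw [← mul_assoc, sub_mul, hx, Algebra.smul_def, Algebra.smul_def]
      congr 1
      abel
    have e : P + S + (x * T + algebraMap R A (yseq a b (n + 1)))
        - algebraMap R A (yseq a b (n + 1)) = P + S + x * T := by abel
    rw [e, mul_add, hT, sub_mul, mul_add, mul_add]
    simp only [Algebra.smul_def]
    abel

lemma HeckeAlg.pi_sq {R : Type*} [CommRing R] (a b : R) {B : Type*} (Cm : CoxeterMatrix B)
    (i : B) : HeckeAlg.pi R a b Cm i * HeckeAlg.pi R a b Cm i
      = a • HeckeAlg.pi R a b Cm i + algebraMap R (HeckeAlg R a b Cm) b := by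
  have h := RingQuot.mkAlgHom_rel R (HeckeRel.quad (R := R) (a := a) (b := b) (Cm := Cm) i)
  rw [map_mul, map_add, map_smul, AlgHom.commutes] at h
  exact h

/-- **Lemma 4.1** (theta braid lemma). In the two-variable Hecke algebra `H_W(a,b)` of a Coxeter
system `(W,S)`, for all generators `π_i, π_j` and all `n ≥ 1`,
`((π_i - a)(π_j - a)(π_i - a)⋯)_n
  = (π_i π_j π_i ⋯)_n + ∑_{m=1}^{n-1} y_{n-m} ((π_i π_j π_i ⋯)_m + (π_j π_i π_j ⋯)_m) + y_n`. -/
theorem heckeAlg_altProd_sub_eq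
    {R : Type*} [CommRing R] (a b : R) {B : Type*} {W : Type*} [Group W]
    (Cm : CoxeterMatrix B) (cs : CoxeterSystem Cm W) (i j : B) (n : ℕ) (hn : 1 ≤ n) :
    altProd (HeckeAlg.pi R a b Cm i - algebraMap R (HeckeAlg R a b Cm) a)
        (HeckeAlg.pi R a b Cm j - algebraMap R (HeckeAlg R a b Cm) a) n
      = altProd (HeckeAlg.pi R a b Cm i) (HeckeAlg.pi R a b Cm j) n
        + ∑ m ∈ Finset.Ico 1 n,
            yseq a b (n - m) •
              (altProd (HeckeAlg.pi R a b Cm i) (HeckeAlg.pi R a b Cm j) m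
                + altProd (HeckeAlg.pi R a b Cm j) (HeckeAlg.pi R a b Cm i) m)
        + algebraMap R (HeckeAlg R a b Cm) (yseq a b n) := by
  obtain ⟨k, rfl⟩ := Nat.exists_eq_add_of_le' hn
  rw [altProd_sub_aux a b k _ _ (HeckeAlg.pi_sq a b Cm i) (HeckeAlg.pi_sq a b Cm j)]
  unfold yconv
  rw [← Finset.sum_range_add_sum_Ico _ hn, ← Finset.sum_range_add_sum_Ico _ hn]
  simp only [smul_add, Finset.sum_add_distrib, Finset.sum_range_one, altProd, Nat.sub_zero,
    ← Algebra.algebraMap_eq_smul_one]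
  abel
end
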